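/- Let k be an algebraically closed field and let a, b, c, d, A, B, C ∈ k. Let T = T(a,b,c,d,1,0; A,B,C,0,d,0) (that is, e = 1 and E = d). Then the family (i,j,l) ↦ y^i·x^j·z^l (for i, j, l ≥ 0) is a k-vector-space basis of T if and only if exactly one of the following mutually exclusive cases holds: (i) d = 1 and A = B = C = 0; (ii) d ≠ 1, A = 0, B = a, a = (b - C)·(d-1), and c·(d-1) = C. -/

import Mathlib

noncomputable section

open FreeAlgebra

/-- The generator `x` of the free algebra `k⟨x,y,z⟩`. -/
def Xf (k : Type*) [Field k] : FreeAlgebra k (Fin 3) := FreeAlgebra.ι k 0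

/-- The generator `y` of the free algebra `k⟨x,y,z⟩`. -/
def Yf (k : Type*) [Field k] : FreeAlgebra k (Fin 3) := FreeAlgebra.ι k 1

/-- The generator `z` of the free algebra `k⟨x,y,z⟩`. -/
def Zf (k : Type*) [Field k] : FreeAlgebra k (Fin 3) := FreeAlgebra.ι k 2

/-- The relations defining `T(a,b,c,d,e,f; A,B,C,D,E,F)`: `xy = yx`,
`zx = a·x² + b·xy + c·y² + d·xz + e·yz + f·z²`, and
`zy = A·x² + B·xy + C·y² + D·xz + E·yz + F·z²`. -/
def Trel (k : Type*) [Field k] (a b c d e f A B C D E F : k) :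
    FreeAlgebra k (Fin 3) → FreeAlgebra k (Fin 3) → Prop := fun m n =>
  (m = Xf k * Yf k ∧ n = Yf k * Xf k) ∨
  (m = Zf k * Xf k ∧
    n = a • (Xf k) ^ 2 + b • (Xf k * Yf k) + c • (Yf k) ^ 2 +
        d • (Xf k * Zf k) + e • (Yf k * Zf k) + f • (Zf k) ^ 2) ∨
  (m = Zf k * Yf k ∧
    n = A • (Xf k) ^ 2 + B • (Xf k * Yf k) + C • (Yf k) ^ 2 +
        D • (Xf k * Zf k) + E • (Yf k * Zf k) + F • (Zf k) ^ 2)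

/-- The algebra `T(a,b,c,d,e,f; A,B,C,D,E,F)`. -/
abbrev Talg (k : Type*) [Field k] (a b c d e f A B C D E F : k) :=
  RingQuot (Trel k a b c d e f A B C D E F)

/-- The image of `x` in `T`. -/
def Tx (k : Type*) [Field k] (a b c d e f A B C D E F : k) :
    Talg k a b c d e f A B C D E F :=
  RingQuot.mkAlgHom k (Trel k a b c d e f A B C D E F) (Xf k)

/-- The image of `y` in `T`. -/
def Ty (k : Type*) [Field k] (a b c d e f A B C D E F : k) :
    Talg k a b c d e f A B C D E F :=
  RingQuot.mkAlgHom k (Trel k a b c d e f A B C D E F) (Yf k)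

/-- The image of `z` in `T`. -/
def Tz (k : Type*) [Field k] (a b c d e f A B C D E F : k) :
    Talg k a b c d e f A B C D E F :=
  RingQuot.mkAlgHom k (Trel k a b c d e f A B C D E F) (Zf k)

/-- The property that the family `(i,j,l) ↦ y^i x^j z^l` is a `k`-vector-space basis of `T`;
following the paper, this is exactly the condition that `T` is a graded twisted tensor
product of `k[x,y]` and `k[z]`. -/
def ThasBasis (k : Type*) [Field k] (a b c d e f A B C D E F : k) : Prop :=
  LinearIndependent k
      (fun p : ℕ × ℕ × ℕ =>
        (Ty k a b c d e f A B C D E F) ^ p.1 * (Tx k a b c d e f A B C D E F) ^ p.2.1 *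
          (Tz k a b c d e f A B C D E F) ^ p.2.2) ∧
    Submodule.span k
      (Set.range fun p : ℕ × ℕ × ℕ =>
        (Ty k a b c d e f A B C D E F) ^ p.1 * (Tx k a b c d e f A B C D E F) ^ p.2.1 *
          (Tz k a b c d e f A B C D E F) ^ p.2.2) = ⊤

section Relations

variable {k : Type*} [Field k] (a b c d e f A B C D E F : k)

theorem Tx_mul_Ty :
    Tx k a b c d e f A B C D E F * Ty k a b c d e f A B C D E F =
      Ty k a b c d e f A B C D E F * Tx k a b c d e f A B C D E F := by
  have h := RingQuot.mkAlgHom_rel k (s := Trel k a b c d e f A B C D E F) (Or.inl ⟨rfl, rfl⟩)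
  simpa only [Tx, Ty, map_mul] using h

theorem Tz_mul_Tx :
    Tz k a b c d e f A B C D E F * Tx k a b c d e f A B C D E F =
      a • Tx k a b c d e f A B C D E F ^ 2 +
        b • (Tx k a b c d e f A B C D E F * Ty k a b c d e f A B C D E F) +
        c • Ty k a b c d e f A B C D E F ^ 2 +
        d • (Tx k a b c d e f A B C D E F * Tz k a b c d e f A B C D E F) +
        e • (Ty k a b c d e f A B C D E F * Tz k a b c d e f A B C D E F) +
        f • Tz k a b c d e f A B C D E F ^ 2 := by
  have h := RingQuot.mkAlgHom_rel k (s := Trel k a b c d e f A B C D E F)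
    (Or.inr (Or.inl ⟨rfl, rfl⟩))
  simpa only [Tx, Ty, Tz, map_mul, map_add, map_smul, map_pow] using h

theorem Tz_mul_Ty :
    Tz k a b c d e f A B C D E F * Ty k a b c d e f A B C D E F =
      A • Tx k a b c d e f A B C D E F ^ 2 +
        B • (Tx k a b c d e f A B C D E F * Ty k a b c d e f A B C D E F) +
        C • Ty k a b c d e f A B C D E F ^ 2 +
        D • (Tx k a b c d e f A B C D E F * Tz k a b c d e f A B C D E F) +
        E • (Ty k a b c d e f A B C D E F * Tz k a b c d e f A B C D E F) +
        F • Tz k a b c d e f A B C D E F ^ 2 := by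
  have h := RingQuot.mkAlgHom_rel k (s := Trel k a b c d e f A B C D E F)
    (Or.inr (Or.inr ⟨rfl, rfl⟩))
  simpa only [Tx, Ty, Tz, map_mul, map_add, map_smul, map_pow] using h

/-- A subalgebra of `T` containing the three generators is everything. -/
theorem subalgebra_eq_top_of_generators_mem (W : Subalgebra k (Talg k a b c d e f A B C D E F))
    (hx : Tx k a b c d e f A B C D E F ∈ W) (hy : Ty k a b c d e f A B C D E F ∈ W)
    (hz : Tz k a b c d e f A B C D E F ∈ W) : W = ⊤ := by
  refine eq_top_iff.2 fun t _ => ?_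
  obtain ⟨r, rfl⟩ := RingQuot.mkAlgHom_surjective k (Trel k a b c d e f A B C D E F) t
  induction r with
  | grade0 s => simpa only [AlgHom.commutes] using W.algebraMap_mem s
  | grade1 i => fin_cases i; exacts [hx, hy, hz]
  | mul r s hr hs => simpa only [map_mul] using W.mul_mem (hr trivial) (hs trivial)
  | add r s hr hs => simpa only [map_add] using W.add_mem (hr trivial) (hs trivial)

end Relations

/-- The elements of an algebra whose left multiplication preserves a given submodule. -/
def leftStabilizer {k T : Type*} [CommSemiring k] [Semiring T] [Algebra k T]
    (V : Submodule k T) : Subalgebra k T where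
  carrier := {r | ∀ v ∈ V, r * v ∈ V}
  mul_mem' hr hs v hv := by rw [mul_assoc]; exact hr _ (hs v hv)
  add_mem' hr hs v hv := by rw [add_mul]; exact V.add_mem (hr v hv) (hs v hv)
  algebraMap_mem' s v hv := by rw [← Algebra.smul_def]; exact V.smul_mem s hv

/-- If left multiplication by `z` moves past `x` and `y` in Ore fashion, it moves past every
element of the subalgebra generated by `x` and `y`. -/
theorem exists_mul_eq_mul_add_of_mem_adjoin {k T : Type*} [CommRing k] [Ring T] [Algebra k T]
    {s : Set T} {z : T}
    (h : ∀ r ∈ s, ∃ u ∈ Algebra.adjoin k s, ∃ v ∈ Algebra.adjoin k s, z * r = u * z + v)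
    {r : T} (hr : r ∈ Algebra.adjoin k s) :
    ∃ u ∈ Algebra.adjoin k s, ∃ v ∈ Algebra.adjoin k s, z * r = u * z + v := by
  induction hr using Algebra.adjoin_induction with
  | mem r hr => exact h r hr
  | algebraMap t =>
    exact ⟨algebraMap k T t, Subalgebra.algebraMap_mem _ t, 0, Subalgebra.zero_mem _, by
      rw [add_zero, Algebra.commutes]⟩
  | add r r' _ _ hr hr' =>
    obtain ⟨u, hu, v, hv, e⟩ := hr
    obtain ⟨u', hu', v', hv', e'⟩ := hr'
    exact ⟨u + u', add_mem hu hu', v + v', add_mem hv hv', by rw [mul_add, e, e']; noncomm_ring⟩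
  | mul r r' _ hr₂ hr hr' =>
    obtain ⟨u, hu, v, hv, e⟩ := hr
    obtain ⟨u', hu', v', hv', e'⟩ := hr'
    exact ⟨u * u', mul_mem hu hu', u * v' + v * r',
      add_mem (mul_mem hu hv') (mul_mem hv hr₂), by
        rw [← mul_assoc, e, add_mul, mul_assoc u, e']; noncomm_ring⟩

/-- If `f = F = 0`, the ordered monomials span `T`. -/
theorem span_monomials_eq_top {k : Type*} [Field k] (a b c d e A B C D E : k) :
    Submodule.span k
      (Set.range fun p : ℕ × ℕ × ℕ =>
        (Ty k a b c d e 0 A B C D E 0) ^ p.1 * (Tx k a b c d e 0 A B C D E 0) ^ p.2.1 *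
          (Tz k a b c d e 0 A B C D E 0) ^ p.2.2) = ⊤ := by
  have hxy := Tx_mul_Ty a b c d e 0 A B C D E 0
  have hzx := Tz_mul_Tx a b c d e 0 A B C D E 0
  have hzy := Tz_mul_Ty a b c d e 0 A B C D E 0
  have htop := subalgebra_eq_top_of_generators_mem a b c d e 0 A B C D E 0
  set x := Tx k a b c d e 0 A B C D E 0
  set y := Ty k a b c d e 0 A B C D E 0
  set z := Tz k a b c d e 0 A B C D E 0
  set V := Submodule.span k (Set.range fun p : ℕ × ℕ × ℕ => y ^ p.1 * x ^ p.2.1 * z ^ p.2.2)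
    with hV
  have mono_mem (i j l : ℕ) : y ^ i * x ^ j * z ^ l ∈ V := Submodule.subset_span ⟨(i, j, l), rfl⟩
  have mem_stab {r} (h : ∀ i j l : ℕ, r * (y ^ i * x ^ j * z ^ l) ∈ V) :
      r ∈ leftStabilizer V := fun v hv => by
    refine (Submodule.span_le (p := V.comap (LinearMap.mulLeft k r))).2 ?_ hv
    rintro _ ⟨⟨i, j, l⟩, rfl⟩
    exact h i j l
  have hy : y ∈ leftStabilizer V := mem_stab fun i j l => by
    simpa only [pow_succ', mul_assoc] using mono_mem (i + 1) j l
  have hx : x ∈ leftStabilizer V := mem_stab fun i j l => by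
    have hc : Commute x y := hxy
    have h := mono_mem i (j + 1) l
    rwa [pow_succ', ← mul_assoc, ← (hc.pow_right i).eq, mul_assoc x, mul_assoc x] at h
  set P := Algebra.adjoin k ({x, y} : Set (Talg k a b c d e 0 A B C D E 0))
  have hxP : x ∈ P := Algebra.subset_adjoin (by simp)
  have hyP : y ∈ P := Algebra.subset_adjoin (by simp)
  have hP : P ≤ leftStabilizer V := Algebra.adjoin_le (by
    rintro _ (rfl | rfl)
    exacts [hx, hy])
  have quad_mem (α β γ : k) : α • x ^ 2 + β • (x * y) + γ • y ^ 2 ∈ P :=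
    add_mem (add_mem (P.smul_mem (pow_mem hxP 2) α) (P.smul_mem (mul_mem hxP hyP) β))
      (P.smul_mem (pow_mem hyP 2) γ)
  have lin_mem (α β : k) : α • x + β • y ∈ P := add_mem (P.smul_mem hxP α) (P.smul_mem hyP β)
  have hcomm {r} (hr : r ∈ P) : ∃ u ∈ P, ∃ v ∈ P, z * r = u * z + v := by
    refine exists_mul_eq_mul_add_of_mem_adjoin ?_ hr
    rintro _ (rfl | rfl)
    · refine ⟨_, lin_mem d e, _, quad_mem a b c, ?_⟩
      rw [hzx, add_mul, smul_mul_assoc, smul_mul_assoc]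
      module
    · refine ⟨_, lin_mem D E, _, quad_mem A B C, ?_⟩
      rw [hzy, add_mul, smul_mul_assoc, smul_mul_assoc]
      module
  have hz : z ∈ leftStabilizer V := mem_stab fun i j l => by
    obtain ⟨u, hu, v, hv, huv⟩ := hcomm (mul_mem (pow_mem hyP i) (pow_mem hxP j))
    rw [← mul_assoc, huv, add_mul, mul_assoc, ← pow_succ']
    have hpow (m : ℕ) : z ^ m ∈ V := by simpa using mono_mem 0 0 m
    exact V.add_mem (hP hu _ (hpow _)) (hP hv _ (hpow _))
  refine eq_top_iff.2 fun t _ => ?_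
  have ht : t ∈ leftStabilizer V := htop _ hx hy hz ▸ Algebra.mem_top
  simpa using ht 1 (by simpa using mono_mem 0 0 0)

/-- The obstruction to the overlap `zxy = zyx` being resolvable. -/
theorem overlap_eq_zero {k T : Type*} [Field k] [Ring T] [Algebra k T] {x y z : T}
    {a b c d A B C : k} (hxy : x * y = y * x)
    (hzx : z * x = a • x ^ 2 + b • (x * y) + c • y ^ 2 + d • (x * z) + y * z)
    (hzy : z * y = A • x ^ 2 + B • (x * y) + C • y ^ 2 + d • (y * z)) :
    ((d - 1) * A) • x ^ 3 + ((d - 1) * B + A - (d - 1) * a) • (y * x ^ 2) +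
      ((d - 1) * C + B - (d - 1) * b) • (y ^ 2 * x) + (C - (d - 1) * c) • y ^ 3 = 0 := by
  have hxy' (w : T) : x * (y * w) = y * (x * w) := by rw [← mul_assoc, hxy, mul_assoc]
  have h : (z * x) * y = (z * y) * x := by rw [mul_assoc, hxy, mul_assoc]
  rw [hzx, hzy] at h
  simp only [add_mul, smul_mul_assoc, mul_assoc, hzx, hzy, mul_add, mul_smul_comm, pow_succ,
    pow_zero, one_mul, hxy, hxy', smul_add, smul_smul] at h ⊢
  rw [← sub_eq_zero] at h
  rw [← h]
  module

theorem coeff_eq_zero_of_linearIndependent {k T : Type*} [Field k] [Ring T] [Algebra k T]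
    {x y z : T}
    (hli : LinearIndependent k fun p : ℕ × ℕ × ℕ => y ^ p.1 * x ^ p.2.1 * z ^ p.2.2)
    {α β γ δ : k}
    (h : α • x ^ 3 + β • (y * x ^ 2) + γ • (y ^ 2 * x) + δ • y ^ 3 = 0) :
    α = 0 ∧ β = 0 ∧ γ = 0 ∧ δ = 0 := by
  have hinj : Function.Injective
      (![(0, 3, 0), (1, 2, 0), (2, 1, 0), (3, 0, 0)] : Fin 4 → ℕ × ℕ × ℕ) := by decide
  have h' := Fintype.linearIndependent_iff.1 (hli.comp _ hinj) ![α, β, γ, δ]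
    (by simpa [Fin.sum_univ_four] using h)
  exact ⟨h' 0, h' 1, h' 2, h' 3⟩

section Representation

open Polynomial

theorem linearIndependent_pow_of_transcendental {k L : Type*} [CommRing k] [CommRing L]
    [Algebra k L] {y : L} (hy : Transcendental k y) : LinearIndependent k fun i : ℕ => y ^ i := by
  have h := (Polynomial.basisMonomials k).linearIndependent.map' (aeval y).toLinearMap
    (LinearMap.ker_eq_bot.2 (transcendental_iff_injective.1 hy))
  have e : (fun i : ℕ => y ^ i) = (aeval y).toLinearMap ∘ Polynomial.basisMonomials k := by
    funext i
    simp [Polynomial.aeval_monomial]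
  exact e ▸ h

variable {k R : Type*} [Field k] [CommRing R] [Algebra k R]

/-- The operator `f ↦ (t + w) σ(f) - w f` on `R[t]`. It satisfies
`z ∘ r = σ(r) ∘ z + w (σ(r) - r)` for `r ∈ R`, and sends `t ^ l` to `t ^ (l + 1)`. -/
def oreOperator (σ : R →ₐ[k] R) (w : R) : Module.End k R[X] :=
  LinearMap.mulLeft k (X + Polynomial.C w) ∘ₗ (Polynomial.mapAlgHom σ).toLinearMap -
    LinearMap.mulLeft k (Polynomial.C w)

theorem oreOperator_apply (σ : R →ₐ[k] R) (w : R) (f : R[X]) :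
    oreOperator σ w f =
      (X + Polynomial.C w) * f.map (σ : R →+* R) - Polynomial.C w * f := rfl

theorem oreOperator_pow_apply_one (σ : R →ₐ[k] R) (w : R) (l : ℕ) :
    (oreOperator σ w ^ l) 1 = X ^ l := by
  induction l with
  | zero => simp
  | succ l ih =>
    rw [pow_succ', Module.End.mul_apply, ih, oreOperator_apply, Polynomial.map_pow,
      Polynomial.map_X]
    ring

/-- An endomorphism `σ` of `R` together with an inner `σ`-derivation `r ↦ w (σ(r) - r)` matching
the relations yields a representation of `T` which detects the ordered monomials. -/
theorem linearIndependent_monomials_of_inner {a b c d A B C : k} (σ : R →ₐ[k] R) (x y w : R)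
    (hli : LinearIndependent k fun p : ℕ × ℕ => y ^ p.1 * x ^ p.2)
    (hσx : σ x = d • x + y) (hσy : σ y = d • y)
    (hx : w * (σ x - x) = a • x ^ 2 + b • (x * y) + c • y ^ 2)
    (hy : w * (σ y - y) = A • x ^ 2 + B • (x * y) + C • y ^ 2) :
    LinearIndependent k
      (fun p : ℕ × ℕ × ℕ =>
        (Ty k a b c d 1 0 A B C 0 d 0) ^ p.1 * (Tx k a b c d 1 0 A B C 0 d 0) ^ p.2.1 *
          (Tz k a b c d 1 0 A B C 0 d 0) ^ p.2.2) := by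
  let m : R →ₐ[k] Module.End k R[X] := (Algebra.lmul k R[X]).comp Polynomial.CAlgHom
  have hm (r : R) (f : R[X]) : m r f = Polynomial.C r * f := rfl
  have hcomm (r : R) :
      oreOperator σ w * m r = m (σ r) * oreOperator σ w + m (w * (σ r - r)) := by
    refine LinearMap.ext fun f => ?_
    simp only [Module.End.mul_apply, LinearMap.add_apply, hm, oreOperator_apply,
      Polynomial.map_mul, Polynomial.map_C, Polynomial.C_mul, Polynomial.C_sub,
      RingHom.coe_coe]
    ring
  have hzx := hcomm x
  have hzy := hcomm y
  rw [hx, hσx] at hzx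
  rw [hy, hσy] at hzy
  simp only [map_mul, map_add, map_smul, map_pow] at hzx hzy
  let φ : FreeAlgebra k (Fin 3) →ₐ[k] Module.End k R[X] :=
    FreeAlgebra.lift k ![m x, m y, oreOperator σ w]
  have φx : φ (Xf k) = m x := by simp [φ, Xf]
  have φy : φ (Yf k) = m y := by simp [φ, Yf]
  have φz : φ (Zf k) = oreOperator σ w := by simp [φ, Zf]
  have hφ : ∀ ⦃r s⦄, Trel k a b c d 1 0 A B C 0 d 0 r s → φ r = φ s := by
    rintro r s (⟨rfl, rfl⟩ | ⟨rfl, rfl⟩ | ⟨rfl, rfl⟩)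
    · rw [map_mul, map_mul, φx, φy, ← map_mul, mul_comm, map_mul]
    · simp only [map_mul, map_add, map_smul, map_pow, φx, φy, φz, hzx, add_mul, smul_mul_assoc]
      module
    · simp only [map_mul, map_add, map_smul, map_pow, φx, φy, φz, hzy, smul_mul_assoc]
      module
  let ψ := RingQuot.liftAlgHom k ⟨φ, hφ⟩
  have hψ (r) : ψ (RingQuot.mkAlgHom k _ r) = φ r := RingQuot.liftAlgHom_mkAlgHom_apply k φ hφ r
  let ev := LinearMap.applyₗ (R := k) (1 : R[X]) ∘ₗ ψ.toLinearMap
  refine LinearIndependent.of_comp ev ?_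
  have hli' := linearIndependent_smul hli (Polynomial.basisMonomials R).linearIndependent
  convert hli'.comp (fun p : ℕ × ℕ × ℕ => ((p.1, p.2.1), p.2.2))
    (fun p q h => by simpa [Prod.ext_iff, and_assoc] using h) using 1
  funext p
  simp only [ev, Function.comp_apply, LinearMap.comp_apply, AlgHom.toLinearMap_apply,
    LinearMap.applyₗ_apply_apply, map_mul, map_pow, Tx, Ty, Tz, hψ, φx, φy, φz,
    Module.End.mul_apply, oreOperator_pow_apply_one]
  simp only [← map_pow, hm, Polynomial.coe_basisMonomials, Polynomial.smul_monomial,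
    smul_eq_mul, mul_one, Polynomial.C_mul_X_pow_eq_monomial, Polynomial.C_mul_monomial]

theorem linearIndependent_C_pow_mul_X_pow {L : Type*} [CommRing L] [Algebra k L] {y : L}
    (hy : LinearIndependent k fun i : ℕ => y ^ i) :
    LinearIndependent k fun p : ℕ × ℕ => (Polynomial.C y ^ p.1 * X ^ p.2 : L[X]) := by
  convert linearIndependent_smul hy (Polynomial.basisMonomials L).linearIndependent using 1
  funext p
  rw [Polynomial.coe_basisMonomials, Polynomial.smul_monomial, smul_eq_mul, mul_one,
    ← Polynomial.C_pow, Polynomial.C_mul_X_pow_eq_monomial]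

end Representation

open Polynomial in
theorem linearIndependent_monomials_of_d_eq_one {k : Type*} [Field k] (a b c : k) :
    LinearIndependent k
      (fun p : ℕ × ℕ × ℕ =>
        (Ty k a b c 1 1 0 0 0 0 0 1 0) ^ p.1 * (Tx k a b c 1 1 0 0 0 0 0 1 0) ^ p.2.1 *
          (Tz k a b c 1 1 0 0 0 0 0 1 0) ^ p.2.2) := by
  let y : RatFunc k := RatFunc.X
  have hy : y ≠ 0 := RatFunc.X_ne_zero
  have hy_li : LinearIndependent k fun i : ℕ => y ^ i :=
    linearIndependent_pow_of_transcendental RatFunc.transcendental_X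
  let σ : (RatFunc k)[X] →ₐ[k] (RatFunc k)[X] :=
    (Polynomial.aeval (X + Polynomial.C y)).restrictScalars k
  have hσx : σ X = X + Polynomial.C y := by simp [σ]
  have hσy : σ (Polynomial.C y) = Polynomial.C y := by
    simp [σ, ← Polynomial.algebraMap_eq]
  have hyinv : Polynomial.C y⁻¹ * Polynomial.C y = 1 := by
    rw [← Polynomial.C_mul, inv_mul_cancel₀ hy, Polynomial.C_1]
  refine linearIndependent_monomials_of_inner σ X (Polynomial.C y)
    (Polynomial.C y⁻¹ * (a • X ^ 2 + b • (X * Polynomial.C y) + c • Polynomial.C y ^ 2))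
    (linearIndependent_C_pow_mul_X_pow hy_li) (by rw [hσx, one_smul]) (by rw [hσy, one_smul])
    ?_ (by simp [hσy])
  rw [hσx, add_sub_cancel_left, mul_right_comm, hyinv, one_mul]

open Polynomial in
theorem linearIndependent_monomials_of_coeff_eq {k : Type*} [Field k] {a b c d C : k}
    (ha : a = (b - C) * (d - 1)) (hC : c * (d - 1) = C) :
    LinearIndependent k
      (fun p : ℕ × ℕ × ℕ =>
        (Ty k a b c d 1 0 0 a C 0 d 0) ^ p.1 * (Tx k a b c d 1 0 0 a C 0 d 0) ^ p.2.1 *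
          (Tz k a b c d 1 0 0 a C 0 d 0) ^ p.2.2) := by
  have hX : LinearIndependent k fun i : ℕ => (X : k[X]) ^ i :=
    linearIndependent_pow_of_transcendental (Polynomial.transcendental_X k)
  let y : k[X][X] := Polynomial.C X
  let σ : k[X][X] →ₐ[k] k[X][X] := Polynomial.eval₂AlgHom
    (Polynomial.aeval (d • y)) (d • X + y) (fun _ => Commute.all _ _)
  have hσx : σ X = d • X + y := by simp [σ]
  have hσy : σ y = d • y := by simp [σ, y]
  subst hC
  subst ha
  refine linearIndependent_monomials_of_inner σ X y ((b - c * (d - 1)) • X + c • y)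
    (linearIndependent_C_pow_mul_X_pow hX) hσx hσy ?_ ?_
  · rw [hσx]
    simp only [Algebra.smul_def, map_sub, map_mul, map_one]
    ring
  · rw [hσy]
    simp only [Algebra.smul_def, map_sub, map_mul, map_one, map_zero]
    ring

/-- Classification of Ore-type twisted tensor products with `e = 1` (Theorem 4.4(2)):
for `T = T(a,b,c,d,1,0; A,B,C,0,d,0)`, the family `(i,j,l) ↦ y^i x^j z^l` is a `k`-basis
of `T` iff exactly one of the two mutually exclusive cases (i)-(ii) holds. -/
theorem stmt10 {k : Type*} [Field k] [IsAlgClosed k] (a b c d A B C : k) :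
    ThasBasis k a b c d 1 0 A B C 0 d 0 ↔
      ((d = 1 ∧ A = 0 ∧ B = 0 ∧ C = 0) ∨
       (d ≠ 1 ∧ A = 0 ∧ B = a ∧ a = (b - C) * (d - 1) ∧ c * (d - 1) = C)) := by
  constructor
  · rintro ⟨hli, -⟩
    have hzx := Tz_mul_Tx a b c d 1 0 A B C 0 d 0
    have hzy := Tz_mul_Ty a b c d 1 0 A B C 0 d 0
    simp only [one_smul, zero_smul, add_zero] at hzx hzy
    obtain ⟨h₁, h₂, h₃, h₄⟩ := coeff_eq_zero_of_linearIndependent hli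
      (overlap_eq_zero (Tx_mul_Ty a b c d 1 0 A B C 0 d 0) hzx hzy)
    by_cases hd : d = 1
    · subst hd
      exact Or.inl ⟨rfl, by linear_combination h₂, by linear_combination h₃,
        by linear_combination h₄⟩
    · have hd' : d - 1 ≠ 0 := sub_ne_zero.2 hd
      have hA : A = 0 := (mul_eq_zero.1 h₁).resolve_left hd'
      have hB : B = a := mul_left_cancel₀ hd' (by linear_combination h₂ - hA)
      exact Or.inr ⟨hd, hA, hB, by linear_combination h₃ - hB, by linear_combination -h₄⟩
  · rintro (⟨rfl, rfl, rfl, rfl⟩ | ⟨-, rfl, rfl, ha, hC⟩)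
    · exact ⟨linearIndependent_monomials_of_d_eq_one a b c, span_monomials_eq_top ..⟩
    · exact ⟨linearIndependent_monomials_of_coeff_eq ha hC, span_monomials_eq_top ..⟩
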